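/- Let λ > 0 and z ∈ ℝ⁴ with z₁ ≥ z₂ ≥ z₃ ≥ z₄ > 0. Define f(w) = (1/2)‖w − z‖² + λ(w₁w₂w₃ + w₂w₃w₄ + w₃w₄w₁ + w₄w₁w₂) on ℝ⁴ and g(w) = (1/2)Σ_{i=1}^{3}(w_i − z_i)² + λ w₁w₂w₃ on ℝ³, and let ∇²f and ∇²g denote their Hessians. Set v₂ = f((z₁, z₂, 0, 0)), v₃ = (1/2)z₄² + inf{ g(w) : w ∈ ℝ³, w ≥ 0, ∇²g(w) positive semidefinite }, and v₄ = inf{ f(w) : w ∈ ℝ⁴, w ≥ 0, ∇²f(w) positive semidefinite }. Then min_{w ∈ ℝ₊⁴} f(w) = min{v₂, v₃, v₄}; in particular, a point among (z₁,z₂,0,0), an optimal solution of the 3-dimensional convex problem extended by a zero fourth coordinate, and an optimal solution of the 4-dimensional convex problem achieving the smallest f-value is a global minimizer of f over ℝ₊⁴. -/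

import Mathlib

open Finset

/-- The smooth 2:4 objective `f(w) = (1/2)‖w − z‖² + λ(w₁w₂w₃ + w₂w₃w₄ + w₃w₄w₁ + w₄w₁w₂)`. -/
noncomputable def fObj (lam : ℝ) (z w : Fin 4 → ℝ) : ℝ :=
  (1 / 2) * (∑ i, (w i - z i) ^ 2) +
    lam * (w 0 * w 1 * w 2 + w 1 * w 2 * w 3 + w 2 * w 3 * w 0 + w 3 * w 0 * w 1)

/-- The smooth 3-variable objective `g(w) = (1/2)∑ᵢ(wᵢ − zᵢ)² + λ w₁w₂w₃`. -/
noncomputable def gObj (lam : ℝ) (z w : Fin 3 → ℝ) : ℝ :=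
  (1 / 2) * (∑ i, (w i - z i) ^ 2) + lam * (w 0 * w 1 * w 2)

/-- The Hessian `∇²f(w)`: ones on the diagonal, off-diagonal entry `λ(wₖ + wₗ)` with
`{k,l} = {1,2,3,4} \ {i,j}`. -/
noncomputable def hessF (lam : ℝ) (w : Fin 4 → ℝ) : Matrix (Fin 4) (Fin 4) ℝ :=
  Matrix.of fun i j =>
    if i = j then 1 else lam * ∑ k ∈ univ.filter (fun k : Fin 4 => k ≠ i ∧ k ≠ j), w k

/-- The Hessian `∇²g(w)`: ones on the diagonal, off-diagonal entry `λ wₖ` with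
`{k} = {1,2,3} \ {i,j}`. -/
noncomputable def hessG (lam : ℝ) (w : Fin 3 → ℝ) : Matrix (Fin 3) (Fin 3) ℝ :=
  Matrix.of fun i j =>
    if i = j then 1 else lam * ∑ k ∈ univ.filter (fun k : Fin 3 => k ≠ i ∧ k ≠ j), w k

open Matrix in
lemma posSemidef_of_forall_real {n : ℕ} {M : Matrix (Fin n) (Fin n) ℝ} (hM : M.IsSymm)
    (h : ∀ d : Fin n → ℝ, 0 ≤ d ⬝ᵥ (M *ᵥ d)) : M.PosSemidef := by
  refine PosSemidef.of_dotProduct_mulVec_nonneg ?_ fun d => by simpa using h d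
  rw [IsHermitian, conjTranspose_eq_transpose_of_trivial]
  exact hM

lemma hessF_isSymm (lam : ℝ) (w : Fin 4 → ℝ) : (hessF lam w).IsSymm := by
  ext i j
  simp only [hessF, Matrix.transpose_apply, Matrix.of_apply, eq_comm (a := j) (b := i),
    and_comm]

lemma hessG_isSymm (lam : ℝ) (w : Fin 3 → ℝ) : (hessG lam w).IsSymm := by
  ext i j
  simp only [hessG, Matrix.transpose_apply, Matrix.of_apply, eq_comm (a := j) (b := i),
    and_comm]

open Matrix in
/-- The second difference of `fObj` is exactly the Hessian form, since `fObj` is cubic. -/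
lemma fObj_second_difference (lam : ℝ) (z w d : Fin 4 → ℝ) (t : ℝ) :
    fObj lam z (w + t • d) + fObj lam z (w - t • d) - 2 * fObj lam z w =
      t ^ 2 * (d ⬝ᵥ (hessF lam w *ᵥ d)) := by
  simp [fObj, hessF, dotProduct, mulVec, Fin.sum_univ_four, Finset.sum_filter]
  ring

open Matrix in
/-- The second difference of `gObj` is exactly the Hessian form, since `gObj` is cubic. -/
lemma gObj_second_difference (lam : ℝ) (z w d : Fin 3 → ℝ) (t : ℝ) :
    gObj lam z (w + t • d) + gObj lam z (w - t • d) - 2 * gObj lam z w =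
      t ^ 2 * (d ⬝ᵥ (hessG lam w *ᵥ d)) := by
  simp [gObj, hessG, dotProduct, mulVec, Fin.sum_univ_three, Finset.sum_filter]
  ring

lemma exists_pos_add_sub_smul_nonneg {n : ℕ} {w : Fin n → ℝ} (hw : ∀ i, 0 < w i)
    (d : Fin n → ℝ) :
    ∃ t : ℝ, 0 < t ∧ (∀ i, 0 ≤ (w + t • d) i) ∧ ∀ i, 0 ≤ (w - t • d) i := by
  have key : ∀ᶠ t in nhdsWithin (0 : ℝ) (Set.Ioi 0),
      ∀ i, 0 ≤ (w + t • d) i ∧ 0 ≤ (w - t • d) i := by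
    refine Filter.Eventually.filter_mono nhdsWithin_le_nhds (Filter.eventually_all.2 fun i => ?_)
    have h1 : ContinuousAt (fun t : ℝ => (w + t • d) i) 0 := by
      simp only [Pi.add_apply, Pi.smul_apply]; fun_prop
    have h2 : ContinuousAt (fun t : ℝ => (w - t • d) i) 0 := by
      simp only [Pi.sub_apply, Pi.smul_apply]; fun_prop
    filter_upwards [h1.eventually (lt_mem_nhds (a := 0) (by simpa using hw i)),
      h2.eventually (lt_mem_nhds (a := 0) (by simpa using hw i))] with t ht1 ht2
    exact ⟨ht1.le, ht2.le⟩
  obtain ⟨t, ht, ht0⟩ := (key.and self_mem_nhdsWithin).exists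
  exact ⟨t, ht0, fun i => (ht i).1, fun i => (ht i).2⟩

lemma hessF_posSemidef_of_interior_min {lam : ℝ} {z w : Fin 4 → ℝ} (hw : ∀ i, 0 < w i)
    (hmin : ∀ u : Fin 4 → ℝ, (∀ i, 0 ≤ u i) → fObj lam z w ≤ fObj lam z u) :
    (hessF lam w).PosSemidef := by
  refine posSemidef_of_forall_real (hessF_isSymm lam w) fun d => ?_
  obtain ⟨t, ht, hp, hm⟩ := exists_pos_add_sub_smul_nonneg hw d
  have h := fObj_second_difference lam z w d t
  exact nonneg_of_mul_nonneg_right (by linarith [hmin _ hp, hmin _ hm]) (pow_pos ht 2)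

lemma hessG_posSemidef_of_interior_min {lam : ℝ} {z w : Fin 3 → ℝ} (hw : ∀ i, 0 < w i)
    (hmin : ∀ u : Fin 3 → ℝ, (∀ i, 0 ≤ u i) → gObj lam z w ≤ gObj lam z u) :
    (hessG lam w).PosSemidef := by
  refine posSemidef_of_forall_real (hessG_isSymm lam w) fun d => ?_
  obtain ⟨t, ht, hp, hm⟩ := exists_pos_add_sub_smul_nonneg hw d
  have h := gObj_second_difference lam z w d t
  exact nonneg_of_mul_nonneg_right (by linarith [hmin _ hp, hmin _ hm]) (pow_pos ht 2)

lemma hessF_zero_posSemidef (lam : ℝ) : (hessF lam 0).PosSemidef := by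
  have : hessF lam 0 = 1 := by ext i j; simp [hessF, Matrix.one_apply]
  rw [this]; exact Matrix.PosSemidef.one

lemma hessG_zero_posSemidef (lam : ℝ) : (hessG lam 0).PosSemidef := by
  have : hessG lam 0 = 1 := by ext i j; simp [hessG, Matrix.one_apply]
  rw [this]; exact Matrix.PosSemidef.one

lemma fObj_snoc_zero (lam : ℝ) (z : Fin 4 → ℝ) (u : Fin 3 → ℝ) :
    fObj lam z (Fin.snoc u 0 : Fin 4 → ℝ) =
      (1 / 2) * (z 3) ^ 2 + gObj lam (fun i : Fin 3 => z i.castSucc) u := by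
  have h0 : (Fin.snoc u 0 : Fin 4 → ℝ) 0 = u 0 := rfl
  have h1 : (Fin.snoc u 0 : Fin 4 → ℝ) 1 = u 1 := rfl
  have h2 : (Fin.snoc u 0 : Fin 4 → ℝ) 2 = u 2 := rfl
  have h3 : (Fin.snoc u 0 : Fin 4 → ℝ) 3 = 0 := rfl
  have c0 : (0 : Fin 3).castSucc = (0 : Fin 4) := rfl
  have c1 : (1 : Fin 3).castSucc = (1 : Fin 4) := rfl
  have c2 : (2 : Fin 3).castSucc = (2 : Fin 4) := rfl
  simp only [fObj, gObj, Fin.sum_univ_four, Fin.sum_univ_three, h0, h1, h2, h3, c0, c1, c2]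
  ring

lemma snoc_zero_nonneg {u : Fin 3 → ℝ} (hu : ∀ i, 0 ≤ u i) (i : Fin 4) :
    0 ≤ (Fin.snoc u 0 : Fin 4 → ℝ) i := by
  induction i using Fin.lastCases with
  | last => exact (Fin.snoc_last (α := fun _ => ℝ) (0 : ℝ) u).ge
  | cast i => simpa using hu i

/-- Truncating a nonnegative point at `z` does not increase the objective. -/
lemma fObj_inf_le {lam : ℝ} (hlam : 0 ≤ lam) {z w : Fin 4 → ℝ} (hz : ∀ i, 0 ≤ z i)
    (hw : ∀ i, 0 ≤ w i) : fObj lam z (w ⊓ z) ≤ fObj lam z w := by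
  have hn : ∀ i, 0 ≤ (w ⊓ z) i := fun i => le_inf (hw i) (hz i)
  have hle : ∀ i, (w ⊓ z) i ≤ w i := fun i => inf_le_left
  have hsq : ∀ i, ((w ⊓ z) i - z i) ^ 2 ≤ (w i - z i) ^ 2 := fun i => by
    rcases le_total (w i) (z i) with h | h
    · simp [inf_eq_left.2 h]
    · simpa [inf_eq_right.2 h] using sq_nonneg (w i - z i)
  have h3 : ∀ i j k, (w ⊓ z) i * (w ⊓ z) j * (w ⊓ z) k ≤ w i * w j * w k := fun i j k =>
    mul_le_mul (mul_le_mul (hle i) (hle j) (hn j) (hw i)) (hle k) (hn k)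
      (mul_nonneg (hw i) (hw j))
  unfold fObj
  gcongr ?_ * ?_ + lam * (?_ + ?_ + ?_ + ?_)
  · exact Finset.sum_le_sum fun i _ => hsq i
  all_goals exact h3 _ _ _

lemma exists_fObj_min {lam : ℝ} (hlam : 0 ≤ lam) {z : Fin 4 → ℝ} (hz : ∀ i, 0 ≤ z i) :
    ∃ w : Fin 4 → ℝ, (∀ i, 0 ≤ w i) ∧
      ∀ u : Fin 4 → ℝ, (∀ i, 0 ≤ u i) → fObj lam z w ≤ fObj lam z u := by
  have hc : Continuous (fObj lam z) := by unfold fObj; fun_prop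
  obtain ⟨w, hw, hmin⟩ := (isCompact_Icc (a := (0 : Fin 4 → ℝ)) (b := z)).exists_isMinOn
    ⟨0, le_rfl, hz⟩ hc.continuousOn
  refine ⟨w, hw.1, fun u hu => le_trans (hmin ⟨le_inf hu hz, inf_le_right⟩)
    (fObj_inf_le hlam hz hu)⟩

/-- Moving a zero coordinate to the last position does not increase the objective when the last
entry of `z` is smallest. -/
lemma fObj_comp_swap_le {lam : ℝ} {z w : Fin 4 → ℝ} {i : Fin 4} (hz : z 3 ≤ z i)
    (hw : 0 ≤ w 3) (hi : w i = 0) :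
    fObj lam z (w ∘ Equiv.swap i 3) ≤ fObj lam z w := by
  have hm := mul_le_mul_of_nonneg_left hz hw
  fin_cases i
  · have e0 : Equiv.swap (0 : Fin 4) 3 0 = 3 := by decide
    have e1 : Equiv.swap (0 : Fin 4) 3 1 = 1 := by decide
    have e2 : Equiv.swap (0 : Fin 4) 3 2 = 2 := by decide
    have e3 : Equiv.swap (0 : Fin 4) 3 3 = 0 := by decide
    simp only [Fin.zero_eta, fObj, Fin.sum_univ_four, Function.comp, e0, e1, e2, e3] at *
    rw [hi]; linarith
  · have e0 : Equiv.swap (1 : Fin 4) 3 0 = 0 := by decide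
    have e1 : Equiv.swap (1 : Fin 4) 3 1 = 3 := by decide
    have e2 : Equiv.swap (1 : Fin 4) 3 2 = 2 := by decide
    have e3 : Equiv.swap (1 : Fin 4) 3 3 = 1 := by decide
    simp only [Fin.mk_one, fObj, Fin.sum_univ_four, Function.comp, e0, e1, e2, e3] at *
    rw [hi]; linarith
  · have e0 : Equiv.swap (2 : Fin 4) 3 0 = 0 := by decide
    have e1 : Equiv.swap (2 : Fin 4) 3 1 = 1 := by decide
    have e2 : Equiv.swap (2 : Fin 4) 3 2 = 3 := by decide
    have e3 : Equiv.swap (2 : Fin 4) 3 3 = 2 := by decide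
    simp only [Fin.reduceFinMk, fObj, Fin.sum_univ_four, Function.comp, e0, e1, e2, e3] at *
    rw [hi]; linarith
  · simp

/-- A point with two zero coordinates, one of them the last, is no better than
`(z₁, z₂, 0, 0)`. -/
lemma fObj_two_sparse_le {lam : ℝ} {z w : Fin 4 → ℝ}
    (hz : z 0 ≥ z 1 ∧ z 1 ≥ z 2 ∧ z 2 ≥ z 3 ∧ z 3 > 0) (h3 : w 3 = 0)
    {j : Fin 3} (hj : w j.castSucc = 0) :
    fObj lam z ![z 0, z 1, 0, 0] ≤ fObj lam z w := by
  obtain ⟨h01, h12, h23, hpos⟩ := hz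
  have hl : fObj lam z ![z 0, z 1, 0, 0] = (1 / 2) * (z 2 ^ 2 + z 3 ^ 2) := by
    simp [fObj, Fin.sum_univ_four]
  have hr : (1 / 2) * (z j.castSucc ^ 2 + z 3 ^ 2) ≤ fObj lam z w := by
    fin_cases j <;> simp [fObj, Fin.sum_univ_four, h3] at hj ⊢ <;> simp [hj] <;>
      nlinarith [sq_nonneg (w 0 - z 0), sq_nonneg (w 1 - z 1), sq_nonneg (w 2 - z 2)]
  have hjz : z 2 ≤ z j.castSucc := by
    fin_cases j <;> simp <;> linarith
  have := pow_le_pow_left₀ (hpos.le.trans h23) hjz 2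
  linarith

/-- The objective has a global minimizer over the orthant that is feasible for one of the three
subproblems. -/
lemma exists_min_cases {lam : ℝ} (hlam : 0 ≤ lam) {z : Fin 4 → ℝ}
    (hz : z 0 ≥ z 1 ∧ z 1 ≥ z 2 ∧ z 2 ≥ z 3 ∧ z 3 > 0) :
    ∃ w : Fin 4 → ℝ, (∀ i, 0 ≤ w i) ∧
      (∀ u : Fin 4 → ℝ, (∀ i, 0 ≤ u i) → fObj lam z w ≤ fObj lam z u) ∧
      (w = ![z 0, z 1, 0, 0] ∨
        (∃ v : Fin 3 → ℝ, (∀ i, 0 ≤ v i) ∧ (hessG lam v).PosSemidef ∧ w = Fin.snoc v 0) ∨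
        (hessF lam w).PosSemidef) := by
  have hz3 : ∀ i, z 3 ≤ z i := by
    obtain ⟨h01, h12, h23, -⟩ := hz
    intro i; fin_cases i <;> simp <;> linarith
  have hz0 : ∀ i, 0 ≤ z i := fun i => hz.2.2.2.le.trans (hz3 i)
  obtain ⟨w, hw, hmin⟩ := exists_fObj_min hlam hz0
  by_cases hall : ∀ i, 0 < w i
  · exact ⟨w, hw, hmin, .inr (.inr (hessF_posSemidef_of_interior_min hall hmin))⟩
  push Not at hall
  obtain ⟨i, hi⟩ := hall
  have hi0 : w i = 0 := le_antisymm hi (hw i)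
  obtain ⟨y, hy, hymin, hy3⟩ : ∃ y : Fin 4 → ℝ, (∀ i, 0 ≤ y i) ∧
      (∀ u : Fin 4 → ℝ, (∀ i, 0 ≤ u i) → fObj lam z y ≤ fObj lam z u) ∧ y 3 = 0 :=
    ⟨w ∘ Equiv.swap i 3, fun k => hw _,
      fun u hu => (fObj_comp_swap_le (hz3 i) (hw 3) hi0).trans (hmin u hu), by simpa using hi0⟩
  by_cases hpos : ∀ j : Fin 3, 0 < y j.castSucc
  · have hsnoc : y = (Fin.snoc (fun j : Fin 3 => y j.castSucc) 0 : Fin 4 → ℝ) := by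
      ext k
      induction k using Fin.lastCases with
      | last => exact hy3.trans (Fin.snoc_last (α := fun _ => ℝ) (0 : ℝ) _).symm
      | cast k => simp
    refine ⟨y, hy, hymin, .inr (.inl ⟨fun j => y j.castSucc, fun j => (hpos j).le, ?_, hsnoc⟩)⟩
    refine hessG_posSemidef_of_interior_min (z := fun i : Fin 3 => z i.castSucc) hpos
      fun u hu => ?_
    have h := hymin _ (snoc_zero_nonneg hu)
    rw [hsnoc, fObj_snoc_zero, fObj_snoc_zero] at h
    exact le_of_add_le_add_left h
  · push Not at hpos
    obtain ⟨j, hj⟩ := hpos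
    have hj0 := le_antisymm hj (hy _)
    refine ⟨![z 0, z 1, 0, 0], ?_, fun u hu =>
      (fObj_two_sparse_le hz hy3 hj0).trans (hymin u hu), .inl rfl⟩
    intro k; fin_cases k <;> simp [hz0]

/-- **Correctness of the enumeration algorithm.** The minimum of `f` over `ℝ₊⁴` equals the
minimum of the values of the three (convex) subproblems: the 2-sparse point `(z₁,z₂,0,0)`, the
3-dimensional problem restricted to `{w ≥ 0, ∇²g(w) ⪰ 0}` (extended by a zero fourth
coordinate, which shifts the value by `(1/2)z₄²`), and the 4-dimensional problem restricted to
`{w ≥ 0, ∇²f(w) ⪰ 0}`. In particular, among the 2-sparse point, an optimal solution of the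
3-dimensional convex problem extended by zero, and an optimal solution of the 4-dimensional
convex problem, any one achieving the smallest `f`-value is a global minimizer of `f` over
`ℝ₊⁴`. -/
theorem prox_enumerate_optimal (lam : ℝ) (hlam : 0 < lam) (z : Fin 4 → ℝ)
    (hz : z 0 ≥ z 1 ∧ z 1 ≥ z 2 ∧ z 2 ≥ z 3 ∧ z 3 > 0) :
    (sInf (fObj lam z '' {w : Fin 4 → ℝ | ∀ i, 0 ≤ w i}) =
      min (fObj lam z ![z 0, z 1, 0, 0])
        (min
          ((1 / 2) * (z 3) ^ 2 +
            sInf (gObj lam (fun i : Fin 3 => z i.castSucc) ''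
              {w : Fin 3 → ℝ | (∀ i, 0 ≤ w i) ∧ (hessG lam w).PosSemidef}))
          (sInf (fObj lam z ''
              {w : Fin 4 → ℝ | (∀ i, 0 ≤ w i) ∧ (hessF lam w).PosSemidef})))) ∧
    (∀ w3 : Fin 3 → ℝ,
      ((∀ i, 0 ≤ w3 i) ∧ (hessG lam w3).PosSemidef ∧
        ∀ u : Fin 3 → ℝ, (∀ i, 0 ≤ u i) → (hessG lam u).PosSemidef →
          gObj lam (fun i : Fin 3 => z i.castSucc) w3 ≤
            gObj lam (fun i : Fin 3 => z i.castSucc) u) →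
      ∀ w4 : Fin 4 → ℝ,
      ((∀ i, 0 ≤ w4 i) ∧ (hessF lam w4).PosSemidef ∧
        ∀ u : Fin 4 → ℝ, (∀ i, 0 ≤ u i) → (hessF lam u).PosSemidef →
          fObj lam z w4 ≤ fObj lam z u) →
      ∀ w ∈ ({![z 0, z 1, 0, 0], Fin.snoc w3 0, w4} : Set (Fin 4 → ℝ)),
        (∀ w' ∈ ({![z 0, z 1, 0, 0], Fin.snoc w3 0, w4} : Set (Fin 4 → ℝ)),
          fObj lam z w ≤ fObj lam z w') →
        ∀ u : Fin 4 → ℝ, (∀ i, 0 ≤ u i) → fObj lam z w ≤ fObj lam z u) := by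
  obtain ⟨m, hm, hmin, hcases⟩ := exists_min_cases hlam.le hz
  have hlow : ∀ u : Fin 3 → ℝ, (∀ i, 0 ≤ u i) →
      fObj lam z m ≤ (1 / 2) * (z 3) ^ 2 + gObj lam (fun i : Fin 3 => z i.castSucc) u :=
    fun u hu => (hmin _ (snoc_zero_nonneg hu)).trans_eq (fObj_snoc_zero lam z u)
  have hp : ∀ i, 0 ≤ (![z 0, z 1, 0, 0] : Fin 4 → ℝ) i := by
    obtain ⟨h01, h12, h23, hpos⟩ := hz
    intro k; fin_cases k <;> simp <;> linarith
  constructor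
  · have hleast : IsLeast (fObj lam z '' {w : Fin 4 → ℝ | ∀ i, 0 ≤ w i}) (fObj lam z m) :=
      ⟨⟨m, hm, rfl⟩, by rintro _ ⟨u, hu, rfl⟩; exact hmin u hu⟩
    rw [hleast.csInf_eq]
    apply le_antisymm
    · refine le_min (hmin _ hp) (le_min ?_ ?_)
      · rw [← sub_le_iff_le_add']
        refine le_csInf ⟨_, 0, ⟨fun _ => le_rfl, hessG_zero_posSemidef lam⟩, rfl⟩ ?_
        rintro _ ⟨u, hu, rfl⟩
        exact sub_le_iff_le_add'.2 (hlow u hu.1)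
      · refine le_csInf ⟨_, 0, ⟨fun _ => le_rfl, hessF_zero_posSemidef lam⟩, rfl⟩ ?_
        rintro _ ⟨u, hu, rfl⟩
        exact hmin u hu.1
    · rcases hcases with h | ⟨v, hv, hvH, h⟩ | h
      · rw [h]; exact min_le_left _ _
      · refine (min_le_right _ _).trans ((min_le_left _ _).trans ?_)
        conv_rhs => rw [h, fObj_snoc_zero]
        gcongr
        refine csInf_le ⟨fObj lam z m - (1 / 2) * (z 3) ^ 2, ?_⟩ ⟨v, ⟨hv, hvH⟩, rfl⟩
        rintro _ ⟨u, hu, rfl⟩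
        exact sub_le_iff_le_add'.2 (hlow u hu.1)
      · refine (min_le_right _ _).trans ((min_le_right _ _).trans ?_)
        refine csInf_le ⟨fObj lam z m, ?_⟩ ⟨m, ⟨hm, h⟩, rfl⟩
        rintro _ ⟨u, hu, rfl⟩
        exact hmin u hu.1
  · rintro w3 ⟨-, -, h3⟩ w4 ⟨-, -, h4⟩ w - hw u hu
    refine le_trans ?_ (hmin u hu)
    rcases hcases with h | ⟨v, hv, hvH, h⟩ | h
    · rw [h]; exact hw _ (by simp)
    · refine (hw (Fin.snoc w3 0) (by simp)).trans ?_
      rw [h, fObj_snoc_zero, fObj_snoc_zero]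
      linarith [h3 v hv hvH]
    · exact (hw w4 (by simp)).trans (h4 m hm h)
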